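/- Let R be a commutative local ring and let ξ₁, ξ₂ ∈ R be such that the principal ideals (ξ₁) and (ξ₂) are prime ideals, ξ₂ ∉ (ξ₁), and ξ₁ ∉ (ξ₂). Let v, w, z be units of R, let p, q, a, b ∈ ℕ, and set f = v·ξ₁ᵖ and g = w·ξ₂^q. If f − g = z·ξ₁ᵃ·ξ₂ᵇ, then p = 0 or q = 0; in particular, f divides g or g divides f in R. -/

import Mathlib

/-- The key step in the proof of Proposition 3.10: in a local ring, if `(ξ₁)` and
`(ξ₂)` are prime ideals with `ξ₂ ∉ (ξ₁)` and `ξ₁ ∉ (ξ₂)`, and `f = v·ξ₁^p`,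
`g = w·ξ₂^q` (with `v, w, z` units) satisfy `f − g = z·ξ₁^a·ξ₂^b`, then `p = 0` or
`q = 0`; in particular `f ∣ g` or `g ∣ f`. -/
theorem divides_of_normal_crossing {R : Type*} [CommRing R] [IsLocalRing R]
    (ξ₁ ξ₂ : R) (h₁ : (Ideal.span {ξ₁}).IsPrime) (h₂ : (Ideal.span {ξ₂}).IsPrime)
    (h₁₂ : ξ₂ ∉ Ideal.span {ξ₁}) (h₂₁ : ξ₁ ∉ Ideal.span {ξ₂})
    (v w z : R) (hv : IsUnit v) (hw : IsUnit w) (hz : IsUnit z)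
    (p q a b : ℕ) (f g : R) (hf : f = v * ξ₁ ^ p) (hg : g = w * ξ₂ ^ q)
    (h : f - g = z * ξ₁ ^ a * ξ₂ ^ b) :
    (p = 0 ∨ q = 0) ∧ (f ∣ g ∨ g ∣ f) := by
  subst hf hg
  have key : p = 0 ∨ q = 0 := by
    by_contra! hpq
    obtain ⟨hp, hq⟩ := hpq
    have hfmem : v * ξ₁ ^ p ∈ Ideal.span {ξ₁} :=
      Ideal.mul_mem_left _ _ (Ideal.pow_mem_of_mem _ (Ideal.mem_span_singleton_self ξ₁) _ hp.bot_lt)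
    have hgmem : w * ξ₂ ^ q ∈ Ideal.span {ξ₂} :=
      Ideal.mul_mem_left _ _ (Ideal.pow_mem_of_mem _ (Ideal.mem_span_singleton_self ξ₂) _ hq.bot_lt)
    have ha : a = 0 := by
      by_contra ha
      have hmem : v * ξ₁ ^ p - w * ξ₂ ^ q ∈ Ideal.span {ξ₁} := by
        rw [h]
        exact Ideal.mul_mem_right _ _ (Ideal.mul_mem_left _ _
          (Ideal.pow_mem_of_mem _ (Ideal.mem_span_singleton_self ξ₁) _ (Nat.pos_of_ne_zero ha)))
      have hg₁ := (Submodule.sub_mem_iff_right _ hfmem).mp hmem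
      exact h₁₂ (h₁.mem_of_pow_mem q ((Ideal.unit_mul_mem_iff_mem _ hw).mp hg₁))
    have hb : b = 0 := by
      by_contra hb
      have hmem : v * ξ₁ ^ p - w * ξ₂ ^ q ∈ Ideal.span {ξ₂} := by
        rw [h]
        exact Ideal.mul_mem_left _ _
          (Ideal.pow_mem_of_mem _ (Ideal.mem_span_singleton_self ξ₂) _ (Nat.pos_of_ne_zero hb))
      have hf₂ := (Submodule.sub_mem_iff_left _ hgmem).mp hmem
      exact h₂₁ (h₂.mem_of_pow_mem p ((Ideal.unit_mul_mem_iff_mem _ hv).mp hf₂))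
    have hmax := sub_mem (IsLocalRing.le_maximalIdeal h₁.ne_top hfmem)
      (IsLocalRing.le_maximalIdeal h₂.ne_top hgmem)
    rw [h, ha, hb, pow_zero, pow_zero, mul_one, mul_one] at hmax
    exact (IsLocalRing.mem_maximalIdeal z).mp hmax hz
  refine ⟨key, ?_⟩
  rcases key with rfl | rfl
  · exact Or.inl (by simpa using hv.dvd)
  · exact Or.inr (by simpa using hw.dvd)
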